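/- arXiv:math/0405375 — 2 statements merged into one kernel-verified Lean document; each statement's English description precedes it below -/
import Mathlib

section
/- Let G be a collection of nonempty subsets of I_n that is closed under passing to nonempty subsets (if ∅ ≠ B ⊆ C and C ∈ G then B ∈ G), and let U be the unital subalgebra of gn generated by {r_C : C ∈ G}. Then there is an isomorphism of left U-modules gn ≅ U ⊕ ⨁_{C ∉ G} U ⊗_k (r_C·gn); concretely, the k-linear map U ⊕ ⨁_{C ∉ G} U ⊗_k (r_C·gn) → gn given by the inclusion on U and by multiplication u ⊗ x ↦ u·x on each summand is a bijection, where C runs over the nonempty subsets of I_n not in G. -/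
/-!
STATEMENT 7: Let `G` be a collection of nonempty subsets of `I_n` closed under passing to
nonempty subsets, and let `U` be the unital subalgebra of `gn` generated by
`{r_C : C ∈ G}`. Then the `k`-linear map
`U ⊕ ⨁_{C ∉ G} U ⊗_k (r_C·gn) → gn`,
given by the inclusion on `U` and by multiplication `u ⊗ x ↦ u·x` on each summand,
is a bijection (here `C` runs over the nonempty subsets of `I_n` not in `G`).
-/

noncomputable section

open Finset TensorProduct

/-- Index type for generators: nonempty subsets `A ⊆ I_n = {1,…,n}` (modeled as `Fin n`). -/
abbrev SubsetIdx (n : ℕ) := {A : Finset (Fin n) // A.Nonempty}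

/-- The free associative unital `k`-algebra `F` on the generators `r_A`. -/
abbrev FreeA (k : Type) [Field k] (n : ℕ) := FreeAlgebra k (SubsetIdx n)

/-- The generator `r_A`, with the convention `r_∅ = 0`. -/
def rGen (k : Type) [Field k] (n : ℕ) (A : Finset (Fin n)) : FreeA k n :=
  if h : A.Nonempty then FreeAlgebra.ι k (⟨A, h⟩ : SubsetIdx n) else 0

/-- The quadratic relation `h_{A;i,j} = r_A (r_{A∖i} - r_{A∖j})`. -/
def hRel (k : Type) [Field k] (n : ℕ) (A : Finset (Fin n)) (i j : Fin n) : FreeA k n :=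
  rGen k n A * (rGen k n (A.erase i) - rGen k n (A.erase j))

/-- The relation identifying each `h_{A;i,j}` (for `i, j ∈ A`) with `0`. -/
inductive GnRel (k : Type) [Field k] (n : ℕ) : FreeA k n → FreeA k n → Prop
  | rel (A : Finset (Fin n)) (i j : Fin n) (hi : i ∈ A) (hj : j ∈ A) :
      GnRel k n (hRel k n A i j) 0

/-- The algebra `gn = F/I`. -/
abbrev Gn (k : Type) [Field k] (n : ℕ) := RingQuot (GnRel k n)

/-- The quotient map `F → gn`. -/
def GnMk (k : Type) [Field k] (n : ℕ) : FreeA k n →ₐ[k] Gn k n :=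
  RingQuot.mkAlgHom k (GnRel k n)

/-- The right ideal `r_C·gn = {r_C·a : a ∈ gn}`, as a `k`-submodule of `gn`
(the range of left multiplication by `r_C`). -/
def rightIdealOf (k : Type) [Field k] (n : ℕ) (C : Finset (Fin n)) : Submodule k (Gn k n) :=
  LinearMap.range (LinearMap.mulLeft k (GnMk k n (rGen k n C)))

/-- The unital subalgebra `U ⊆ gn` generated by `{r_C : C ∈ G}`. -/
def subalgOf (k : Type) [Field k] (n : ℕ) (G : Set (Finset (Fin n))) : Subalgebra k (Gn k n) :=
  Algebra.adjoin k {x : Gn k n | ∃ C ∈ G, x = GnMk k n (rGen k n C)}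

/-- The multiplication map `U ⊗_k N → gn`, `u ⊗ x ↦ u·x`, for a subalgebra `U` and a
`k`-submodule `N` of `gn`. -/
def mulMap (k : Type) [Field k] (n : ℕ) (U : Subalgebra k (Gn k n))
    (N : Submodule k (Gn k n)) : (U ⊗[k] N) →ₗ[k] Gn k n :=
  TensorProduct.lift
    (LinearMap.mk₂ k (fun (u : U) (x : N) => (u : Gn k n) * (x : Gn k n))
      (fun u u' x => by simp [add_mul])
      (fun c u x => by simp [smul_mul_assoc])
      (fun u x x' => by simp [mul_add])
      (fun c u x => by simp [mul_smul_comm]))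

/-- The `k`-linear map `U ⊕ ⨁_{C ∉ G} U ⊗_k (r_C·gn) → gn` of STATEMENT 7. -/
def decompMap (k : Type) [Field k] (n : ℕ) (G : Set (Finset (Fin n))) :
    (subalgOf k n G ×
      DirectSum {C : Finset (Fin n) // C.Nonempty ∧ C ∉ G}
        (fun C => subalgOf k n G ⊗[k] rightIdealOf k n C.1)) →ₗ[k] Gn k n :=
  LinearMap.coprod (subalgOf k n G).val.toLinearMap
    (DirectSum.toModule k _ (Gn k n)
      (fun C => mulMap k n (subalgOf k n G) (rightIdealOf k n C.1)))

section LeftMul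

variable {k R ι : Type*} [CommSemiring k] [Semiring R] [Algebra k R] (U : Subalgebra k R)
  (N : ι → Submodule k R)

/-- The left `U`-action on `U ⊕ ⨁ i, U ⊗_k N i` by multiplication in the `U`-factors. -/
def leftMulAction : U →ₐ[k] Module.End k (U × DirectSum ι fun i => U ⊗[k] N i) :=
  Algebra.lsmul k k _

lemma leftMulAction_fst (u a : U) : leftMulAction U N u (a, 0) = (u * a, 0) :=
  Prod.ext rfl (smul_zero u)

lemma leftMulAction_tmul [DecidableEq ι] (u a : U) (i : ι) (x : N i) :
    leftMulAction U N u (0, DirectSum.lof k ι (fun i => U ⊗[k] N i) i (a ⊗ₜ[k] x)) =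
      (0, DirectSum.lof k ι (fun i => U ⊗[k] N i) i ((u * a) ⊗ₜ[k] x)) :=
  Prod.ext (smul_zero u)
    ((DirectSum.lof U ι (fun i => U ⊗[k] N i) i).map_smul u (a ⊗ₜ[k] x)).symm

end LeftMul

section Action

variable (k : Type) [Field k] (n : ℕ) (G : Set (Finset (Fin n)))

/-- The domain `U ⊕ ⨁_{C ∉ G} U ⊗_k (r_C·gn)` of `decompMap`. -/
abbrev DecompSpace : Type :=
  subalgOf k n G ×
    DirectSum {C : Finset (Fin n) // C.Nonempty ∧ C ∉ G}
      (fun C => subalgOf k n G ⊗[k] rightIdealOf k n C.1)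

/-- The left `U`-action on the decomposition by multiplication in the `U`-factors. -/
def subalgAction : subalgOf k n G →ₐ[k] Module.End k (DecompSpace k n G) :=
  leftMulAction (subalgOf k n G)
    (fun C : {C : Finset (Fin n) // C.Nonempty ∧ C ∉ G} => rightIdealOf k n C.1)

/-- The inclusion `x ↦ 1 ⊗ x` of `r_C·gn` into its summand of the decomposition. -/
def oneTmulIncl (C : {C : Finset (Fin n) // C.Nonempty ∧ C ∉ G}) :
    rightIdealOf k n C.1 →ₗ[k] DecompSpace k n G :=
  LinearMap.inr k _ _ ∘ₗ
    DirectSum.lof k {C : Finset (Fin n) // C.Nonempty ∧ C ∉ G}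
      (fun C => subalgOf k n G ⊗[k] rightIdealOf k n C.1) C ∘ₗ
    TensorProduct.mk k (subalgOf k n G) (rightIdealOf k n C.1) 1

open Classical in
/-- The action of the generator `r_A` on the decomposition: multiplication in the `U`-factors if
`A ∈ G`, and `v ↦ 1 ⊗ r_A·(decompMap v)` otherwise. -/
def genAction (A : SubsetIdx n) : Module.End k (DecompSpace k n G) :=
  if h : A.1 ∈ G then
    subalgAction k n G ⟨GnMk k n (rGen k n A.1), Algebra.subset_adjoin ⟨A.1, h, rfl⟩⟩
  else
    oneTmulIncl k n G ⟨A.1, A.2, h⟩ ∘ₗ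
      (LinearMap.mulLeft k (GnMk k n (rGen k n A.1))).rangeRestrict ∘ₗ decompMap k n G

/-- The action of the free algebra on the decomposition. -/
def freeAction : FreeA k n →ₐ[k] Module.End k (DecompSpace k n G) :=
  FreeAlgebra.lift k (genAction k n G)

variable {k n G}

lemma freeAction_rGen_of_mem {A : Finset (Fin n)} (hA : A.Nonempty) (h : A ∈ G)
    (v : DecompSpace k n G) :
    freeAction k n G (rGen k n A) v =
      subalgAction k n G
        ⟨GnMk k n (rGen k n A), Algebra.subset_adjoin ⟨A, h, rfl⟩⟩ v := by
  have hι : rGen k n A = FreeAlgebra.ι k (⟨A, hA⟩ : SubsetIdx n) := dif_pos hA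
  rw [show freeAction k n G (rGen k n A) = genAction k n G ⟨A, hA⟩ by
    rw [hι]; exact FreeAlgebra.lift_ι_apply _ _, genAction, dif_pos h]

lemma freeAction_rGen_of_notMem {A : Finset (Fin n)} (hA : A.Nonempty) (h : A ∉ G)
    (v : DecompSpace k n G) :
    freeAction k n G (rGen k n A) v =
      oneTmulIncl k n G ⟨A, hA, h⟩
        ⟨GnMk k n (rGen k n A) * decompMap k n G v, decompMap k n G v, rfl⟩ := by
  have hι : rGen k n A = FreeAlgebra.ι k (⟨A, hA⟩ : SubsetIdx n) := dif_pos hA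
  rw [show freeAction k n G (rGen k n A) = genAction k n G ⟨A, hA⟩ by
    rw [hι]; exact FreeAlgebra.lift_ι_apply _ _, genAction, dif_neg h]
  rfl

lemma subalgAction_fst (u a : subalgOf k n G) : subalgAction k n G u (a, 0) = (u * a, 0) :=
  leftMulAction_fst _ _ u a

open Classical in
lemma subalgAction_tmul (u a : subalgOf k n G)
    (C : {C : Finset (Fin n) // C.Nonempty ∧ C ∉ G}) (x : rightIdealOf k n C.1) :
    subalgAction k n G u (0, DirectSum.lof k _
      (fun C : {C : Finset (Fin n) // C.Nonempty ∧ C ∉ G} =>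
        subalgOf k n G ⊗[k] rightIdealOf k n C.1) C (a ⊗ₜ[k] x)) =
      (0, DirectSum.lof k _ (fun C : {C : Finset (Fin n) // C.Nonempty ∧ C ∉ G} =>
        subalgOf k n G ⊗[k] rightIdealOf k n C.1) C ((u * a) ⊗ₜ[k] x)) :=
  leftMulAction_tmul (subalgOf k n G)
    (fun C : {C : Finset (Fin n) // C.Nonempty ∧ C ∉ G} => rightIdealOf k n C.1) u a C x

open Classical in
lemma subalgAction_oneTmulIncl (u : subalgOf k n G)
    (C : {C : Finset (Fin n) // C.Nonempty ∧ C ∉ G}) (x : rightIdealOf k n C.1) :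
    subalgAction k n G u (oneTmulIncl k n G C x) =
      (0, DirectSum.lof k _ (fun C : {C : Finset (Fin n) // C.Nonempty ∧ C ∉ G} =>
        subalgOf k n G ⊗[k] rightIdealOf k n C.1) C (u ⊗ₜ[k] x)) := by
  refine (subalgAction_tmul u 1 C x).trans ?_
  rw [mul_one]

lemma decompMap_oneTmulIncl (C : {C : Finset (Fin n) // C.Nonempty ∧ C ∉ G})
    (x : rightIdealOf k n C.1) : decompMap k n G (oneTmulIncl k n G C x) = x := by
  simp [decompMap, oneTmulIncl, mulMap]

lemma decompMap_fst (u : subalgOf k n G) : decompMap k n G (u, 0) = u := by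
  simp [decompMap]

open Classical in
lemma decompMap_tmul (C : {C : Finset (Fin n) // C.Nonempty ∧ C ∉ G}) (u : subalgOf k n G)
    (x : rightIdealOf k n C.1) :
    decompMap k n G (0, DirectSum.lof k _
      (fun C : {C : Finset (Fin n) // C.Nonempty ∧ C ∉ G} =>
        subalgOf k n G ⊗[k] rightIdealOf k n C.1) C (u ⊗ₜ[k] x)) = u * x := by
  simp [decompMap, mulMap]

lemma decompSpace_hom_ext {M : Type*} [AddCommMonoid M] [Module k M]
    {f g : DecompSpace k n G →ₗ[k] M} (h : ∀ u, f (u, 0) = g (u, 0))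
    (h' : ∀ C u x, f (subalgAction k n G u (oneTmulIncl k n G C x)) =
      g (subalgAction k n G u (oneTmulIncl k n G C x))) : f = g := by
  classical
  refine LinearMap.prod_ext (LinearMap.ext h)
    (DirectSum.linearMap_ext k fun C => TensorProduct.ext' fun u x => ?_)
  have := h' C u x
  rw [subalgAction_oneTmulIncl] at this
  exact this

lemma decompMap_subalgAction (u : subalgOf k n G) (v : DecompSpace k n G) :
    decompMap k n G (subalgAction k n G u v) = u * decompMap k n G v := by
  suffices decompMap k n G ∘ₗ subalgAction k n G u =
      LinearMap.mulLeft k (u : Gn k n) ∘ₗ decompMap k n G from LinearMap.congr_fun this v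
  refine decompSpace_hom_ext (fun a => ?_) fun C a x => ?_
  · simp only [LinearMap.comp_apply, subalgAction_fst, decompMap_fst, LinearMap.mulLeft_apply]
    rfl
  · simp only [LinearMap.comp_apply, subalgAction_oneTmulIncl, subalgAction_tmul,
      decompMap_tmul, LinearMap.mulLeft_apply]
    exact mul_assoc _ _ _

lemma decompMap_freeAction (x : FreeA k n) (v : DecompSpace k n G) :
    decompMap k n G (freeAction k n G x v) = GnMk k n x * decompMap k n G v := by
  induction x using FreeAlgebra.induction generalizing v with
  | grade0 r => simp [Algebra.algebraMap_eq_smul_one]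
  | grade1 A =>
    have hr : FreeAlgebra.ι k A = rGen k n A.1 := by rw [rGen, dif_pos A.2]
    rw [hr]
    by_cases h : A.1 ∈ G
    · rw [freeAction_rGen_of_mem A.2 h, decompMap_subalgAction]
    · rw [freeAction_rGen_of_notMem A.2 h, decompMap_oneTmulIncl]
  | mul a b ha hb => rw [map_mul, Module.End.mul_apply, ha, hb, map_mul, mul_assoc]
  | add a b ha hb => rw [map_add, LinearMap.add_apply, map_add, ha, hb, map_add, add_mul]

lemma GnMk_hRel {A : Finset (Fin n)} {i j : Fin n} (hi : i ∈ A) (hj : j ∈ A) :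
    GnMk k n (hRel k n A i j) = 0 :=
  (RingQuot.mkAlgHom_rel k (GnRel.rel A i j hi hj)).trans (map_zero _)

lemma freeAction_hRel (hG : ∀ C ∈ G, ∀ B ⊆ C, Finset.Nonempty B → B ∈ G)
    {A : Finset (Fin n)} {i j : Fin n} (hi : i ∈ A) (hj : j ∈ A) :
    freeAction k n G (hRel k n A i j) = 0 := by
  let : AddCommGroup (DecompSpace k n G) := Module.addCommMonoidToAddCommGroup k
  have hA : A.Nonempty := ⟨i, hi⟩
  have hrel : GnMk k n (rGen k n A) * GnMk k n (rGen k n (A.erase i)) =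
      GnMk k n (rGen k n A) * GnMk k n (rGen k n (A.erase j)) := by
    rw [← sub_eq_zero, ← mul_sub, ← map_sub, ← map_mul]
    exact GnMk_hRel hi hj
  obtain rfl | hij := eq_or_ne i j
  · rw [hRel, sub_self, mul_zero, map_zero]
  rw [hRel, mul_sub, map_sub, sub_eq_zero, map_mul, map_mul]
  refine LinearMap.ext fun v => ?_
  rw [Module.End.mul_apply, Module.End.mul_apply]
  by_cases h : A ∈ G
  · have hi' : (A.erase i).Nonempty := ⟨j, mem_erase.2 ⟨hij.symm, hj⟩⟩
    have hj' : (A.erase j).Nonempty := ⟨i, mem_erase.2 ⟨hij, hi⟩⟩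
    rw [freeAction_rGen_of_mem hA h, freeAction_rGen_of_mem hA h,
      freeAction_rGen_of_mem hi' (hG A h _ (erase_subset _ _) hi'),
      freeAction_rGen_of_mem hj' (hG A h _ (erase_subset _ _) hj'),
      ← Module.End.mul_apply, ← Module.End.mul_apply, ← map_mul, ← map_mul]
    exact congrArg (fun u => subalgAction k n G u v) (Subtype.ext hrel)
  · rw [freeAction_rGen_of_notMem hA h, freeAction_rGen_of_notMem hA h]
    refine congrArg _ (Subtype.ext ?_)
    change GnMk k n (rGen k n A) * _ = GnMk k n (rGen k n A) * _
    rw [decompMap_freeAction, decompMap_freeAction, ← mul_assoc, ← mul_assoc, hrel]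

/-- The action of `gn` on the decomposition. -/
def gnAction (hG : ∀ C ∈ G, ∀ B ⊆ C, Finset.Nonempty B → B ∈ G) :
    Gn k n →ₐ[k] Module.End k (DecompSpace k n G) :=
  RingQuot.liftAlgHom k ⟨freeAction k n G, by
    rintro _ _ ⟨A, i, j, hi, hj⟩
    rw [freeAction_hRel hG hi hj, map_zero]⟩

lemma gnAction_GnMk (hG : ∀ C ∈ G, ∀ B ⊆ C, Finset.Nonempty B → B ∈ G) (x : FreeA k n) :
    gnAction hG (GnMk k n x) = freeAction k n G x :=
  RingQuot.liftAlgHom_mkAlgHom_apply ..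

lemma decompMap_gnAction (hG : ∀ C ∈ G, ∀ B ⊆ C, Finset.Nonempty B → B ∈ G) (x : Gn k n)
    (v : DecompSpace k n G) :
    decompMap k n G (gnAction hG x v) = x * decompMap k n G v := by
  obtain ⟨x, rfl⟩ := RingQuot.mkAlgHom_surjective k (GnRel k n) x
  exact (congrArg (fun f => decompMap k n G (f v)) (gnAction_GnMk hG x)).trans
    (decompMap_freeAction x v)

lemma gnAction_coe (hGne : ∀ C ∈ G, Finset.Nonempty C)
    (hG : ∀ C ∈ G, ∀ B ⊆ C, Finset.Nonempty B → B ∈ G) (u : subalgOf k n G) :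
    gnAction hG (u : Gn k n) = subalgAction k n G u := by
  obtain ⟨u, hu⟩ := u
  induction hu using Algebra.adjoin_induction with
  | mem x hx =>
    obtain ⟨C, hC, rfl⟩ := hx
    refine LinearMap.ext fun v => ?_
    rw [gnAction_GnMk, freeAction_rGen_of_mem (hGne C hC) hC]
  | algebraMap r =>
    exact ((gnAction hG).commutes r).trans ((subalgAction k n G).commutes r).symm
  | add x y hx hy ihx ihy =>
    exact (map_add (gnAction hG) x y).trans ((congrArg₂ (· + ·) ihx ihy).trans
      (map_add (subalgAction k n G) ⟨x, hx⟩ ⟨y, hy⟩).symm)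
  | mul x y hx hy ihx ihy =>
    exact (map_mul (gnAction hG) x y).trans ((congrArg₂ (· * ·) ihx ihy).trans
      (map_mul (subalgAction k n G) ⟨x, hx⟩ ⟨y, hy⟩).symm)

lemma gnAction_decompMap (hGne : ∀ C ∈ G, Finset.Nonempty C)
    (hG : ∀ C ∈ G, ∀ B ⊆ C, Finset.Nonempty B → B ∈ G) (v : DecompSpace k n G) :
    gnAction hG (decompMap k n G v) (1, 0) = v := by
  suffices (LinearMap.applyₗ ((1, 0) : DecompSpace k n G) ∘ₗ (gnAction hG).toLinearMap) ∘ₗ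
      decompMap k n G = LinearMap.id from LinearMap.congr_fun this v
  refine decompSpace_hom_ext (fun u => ?_) fun C u x => ?_
  · change gnAction hG (decompMap k n G (u, 0)) (1, 0) = (u, 0)
    rw [decompMap_fst, gnAction_coe hGne, subalgAction_fst, mul_one]
  · obtain ⟨_, y, rfl⟩ := x
    change gnAction hG (decompMap k n G (subalgAction k n G u _)) (1, 0) =
      subalgAction k n G u _
    rw [decompMap_subalgAction, decompMap_oneTmulIncl, map_mul, Module.End.mul_apply,
      gnAction_coe hGne]
    congr 1
    change gnAction hG (GnMk k n (rGen k n C.1) * y) (1, 0) = _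
    rw [map_mul, Module.End.mul_apply, gnAction_GnMk, freeAction_rGen_of_notMem C.2.1 C.2.2]
    refine congrArg (oneTmulIncl k n G C) (Subtype.ext ?_)
    change GnMk k n (rGen k n C.1) * _ = GnMk k n (rGen k n C.1) * _
    rw [decompMap_gnAction, decompMap_fst, OneMemClass.coe_one, mul_one]

end Action

theorem decomposition_over_subalgebra (k : Type) [Field k] (n : ℕ) (hn : 2 ≤ n)
    (G : Set (Finset (Fin n)))
    (hGne : ∀ C ∈ G, Finset.Nonempty C)
    (hGclosed : ∀ C ∈ G, ∀ B ⊆ C, Finset.Nonempty B → B ∈ G) :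
    Function.Bijective (decompMap k n G) := by
  refine Function.bijective_iff_has_inverse.2
    ⟨fun x => gnAction hGclosed x (1, 0), gnAction_decompMap hGne hGclosed, fun x => ?_⟩
  rw [decompMap_gnAction, decompMap_fst, OneMemClass.coe_one, mul_one]
end
end

section
/- For every field k, every integer n ≥ 2, and every degree d ≥ 0, the d-th graded components of Q_n and of gn have equal k-vector-space dimensions: dim_k (Q_n)_d = dim_k (gn)_d. -/
/-!
STATEMENT 14: For every field `k`, every integer `n ≥ 2`, and every degree `d ≥ 0`, the
`d`-th graded components of `Q_n` and of `gn` have equal `k`-vector-space dimensions: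
`dim_k (Q_n)_d = dim_k (gn)_d`.
-/

noncomputable section

open Finset

/-- The quadratic relation `f_{A;i,j}` defining `Q_n`. -/
def fRel (k : Type) [Field k] (n : ℕ) (A : Finset (Fin n)) (i j : Fin n) : FreeA k n :=
  rGen k n A * (rGen k n (A.erase i) - rGen k n (A.erase j))
    + (rGen k n (A.erase i) - rGen k n (A.erase j)) * rGen k n ((A.erase i).erase j)
    - rGen k n (A.erase i) ^ 2 + rGen k n (A.erase j) ^ 2

/-- The relation identifying each `f_{A;i,j}` (for `i, j ∈ A`) with `0`. -/
inductive QnRel (k : Type) [Field k] (n : ℕ) : FreeA k n → FreeA k n → Prop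
  | rel (A : Finset (Fin n)) (i j : Fin n) (hi : i ∈ A) (hj : j ∈ A) :
      QnRel k n (fRel k n A i j) 0

/-- The algebra `Q_n`. -/
abbrev Qn (k : Type) [Field k] (n : ℕ) := RingQuot (QnRel k n)

/-- The quotient map `F → Q_n`. -/
def QnMk (k : Type) [Field k] (n : ℕ) : FreeA k n →ₐ[k] Qn k n :=
  RingQuot.mkAlgHom k (QnRel k n)

/-- The degree-`d` component of the free algebra `F`: the `k`-span of the words of length
`d` in the generators. -/
def FreeADeg (k : Type) [Field k] (n : ℕ) (d : ℕ) : Submodule k (FreeA k n) :=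
  Submodule.span k
    {x | ∃ l : List (SubsetIdx n), l.length = d ∧ x = (l.map (FreeAlgebra.ι k)).prod}

/-- The degree-`d` graded component of `Q_n` (the image of that of `F`, the grading being
inherited from `F` as the relations are homogeneous of degree `2`). -/
def QnDeg (k : Type) [Field k] (n : ℕ) (d : ℕ) : Submodule k (Qn k n) :=
  (FreeADeg k n d).map (QnMk k n).toLinearMap

/-- The degree-`d` graded component of `gn`. -/
def GnDeg (k : Type) [Field k] (n : ℕ) (d : ℕ) : Submodule k (Gn k n) :=
  (FreeADeg k n d).map (GnMk k n).toLinearMap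

namespace PseudoRoots

section Words

variable {n : ℕ}

/-- A letter `(v, a)` stands for the `a`-th elementary symmetric function of the pseudo-roots
attached to the subset `v`. -/
abbrev Letter (n : ℕ) := Finset (Fin n) × ℕ

/-- Words are stored reversed, so that the head of the list is the last letter. The word may be
followed by a letter `(x, _)`, no rewriting rule being applicable to the last two letters. -/
def CanAppend : List (Letter n) → Finset (Fin n) → Prop
  | [], _ => True
  | (v, j) :: _, x => ¬ (x ⊆ v ∧ v.card = x.card + j)

/-- The normal words. -/
def IsNormal : List (Letter n) → Prop
  | [] => True
  | (v, j) :: l => 1 ≤ j ∧ j ≤ v.card ∧ CanAppend l v ∧ IsNormal l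

/-- The total degree of a word. -/
def wordDeg (l : List (Letter n)) : ℕ := (l.map Prod.snd).sum

@[simp] lemma wordDeg_cons (p : Letter n) (l : List (Letter n)) :
    wordDeg (p :: l) = p.2 + wordDeg l := by
  simp [wordDeg]

variable (k : Type) [Field k]

/-- The vector space with basis all words. -/
abbrev WordSpace (k : Type) [Field k] (n : ℕ) := List (Letter n) →₀ k

/-- The basis vector given by a word. -/
abbrev word (l : List (Letter n)) : WordSpace k n := Finsupp.single l 1

/-- The span of the normal words. -/
def normalSpan (n : ℕ) : Submodule k (WordSpace k n) :=
  Finsupp.supported k k {l | IsNormal l}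

/-- The span of the normal words of degree `d`. -/
def normalDeg (n d : ℕ) : Submodule k (WordSpace k n) :=
  Finsupp.supported k k {l | IsNormal l ∧ wordDeg l = d}

/-- The span of the normal words which may be followed by a letter `(x, _)`. -/
def tailSpan (x : Finset (Fin n)) : Submodule k (WordSpace k n) :=
  Finsupp.supported k k {l | IsNormal l ∧ CanAppend l x}

/-- The degree-`d` part of `tailSpan`. -/
def tailDeg (x : Finset (Fin n)) (d : ℕ) : Submodule k (WordSpace k n) :=
  Finsupp.supported k k {l | (IsNormal l ∧ CanAppend l x) ∧ wordDeg l = d}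

variable {k}

lemma supported_le_of_word_mem {s : Set (List (Letter n))} {P : Submodule k (WordSpace k n)}
    (h : ∀ l ∈ s, word k l ∈ P) : Finsupp.supported k k s ≤ P := by
  rw [Finsupp.supported_eq_span_single, Submodule.span_le]
  rintro _ ⟨l, hl, rfl⟩
  exact h l hl

lemma word_mem_supported {s : Set (List (Letter n))} {l : List (Letter n)} (h : l ∈ s) :
    word k l ∈ Finsupp.supported k k s :=
  Finsupp.single_mem_supported k 1 h

lemma tailDeg_le_tailSpan (x : Finset (Fin n)) (d : ℕ) : tailDeg k x d ≤ tailSpan k x :=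
  Finsupp.supported_mono fun _ h => h.1

lemma tailDeg_le_normalDeg (x : Finset (Fin n)) (d : ℕ) : tailDeg k x d ≤ normalDeg k n d :=
  Finsupp.supported_mono fun _ h => ⟨h.1.1, h.2⟩

lemma normalDeg_le_normalSpan (d : ℕ) : normalDeg k n d ≤ normalSpan k n :=
  Finsupp.supported_mono fun _ h => h.1

variable (k) in
/-- Appending the letter `(x, a)`, which is `1` for `a = 0` and `0` for `a > |x|`. -/
def appendLetter (x : Finset (Fin n)) (a : ℕ) : WordSpace k n →ₗ[k] WordSpace k n :=
  if a = 0 then LinearMap.id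
  else if a ≤ x.card then Finsupp.lmapDomain k k (List.cons (x, a)) else 0

@[simp] lemma appendLetter_zero (x : Finset (Fin n)) : appendLetter k x 0 = LinearMap.id := by
  simp [appendLetter]

lemma appendLetter_of_card_lt {x : Finset (Fin n)} {a : ℕ} (h : x.card < a) :
    appendLetter k x a = 0 := by
  rw [appendLetter, if_neg (by omega), if_neg (by omega)]

lemma appendLetter_word {x : Finset (Fin n)} {a : ℕ} (ha : 1 ≤ a) (hx : a ≤ x.card)
    (l : List (Letter n)) : appendLetter k x a (word k l) = word k ((x, a) :: l) := by
  rw [appendLetter, if_neg (by omega), if_pos hx]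
  simp

lemma canAppend_cons {v x : Finset (Fin n)} {j : ℕ} {l : List (Letter n)}
    (h : v.card ≠ x.card + j) : CanAppend ((v, j) :: l) x := fun h' => h h'.2

lemma appendLetter_mem_tailDeg_of_ne {v x : Finset (Fin n)} {a : ℕ} (ha : 1 ≤ a)
    {l : List (Letter n)} (hl : IsNormal l) (hv : CanAppend l v) (h : v.card ≠ x.card + a) :
    appendLetter k v a (word k l) ∈ tailDeg k x (wordDeg l + a) := by
  rcases le_or_gt a v.card with hx | hx
  · rw [appendLetter_word ha hx]
    exact word_mem_supported ⟨⟨⟨ha, hx, hv, hl⟩, canAppend_cons h⟩, by simp [add_comm]⟩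
  · rw [appendLetter_of_card_lt hx]
    exact zero_mem _

lemma appendLetter_mem_tailDeg {x : Finset (Fin n)} (a : ℕ) {d : ℕ} {m : WordSpace k n}
    (hm : m ∈ tailDeg k x d) : appendLetter k x a m ∈ tailDeg k x (d + a) := by
  rcases Nat.eq_zero_or_pos a with rfl | ha
  · simpa using hm
  refine (supported_le_of_word_mem (P := (tailDeg k x (d + a)).comap (appendLetter k x a)) ?_) hm
  rintro l ⟨⟨h1, h2⟩, rfl⟩
  exact appendLetter_mem_tailDeg_of_ne ha h1 h2 (by omega)

/-- The solution `d` of the triangular system `∑_{i ≤ b} T (b - i) (d i) = f b`, where `T 0 = 1`. -/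
def triangularSolve {M : Type*} [AddCommGroup M] [Module k M] (T : ℕ → M →ₗ[k] M) (f : ℕ → M) :
    ℕ → M
  | b => f b - ∑ i : Fin b, T (b - i) (triangularSolve T f i)
termination_by b => b
decreasing_by exact i.2

lemma triangularSolve_eq {M : Type*} [AddCommGroup M] [Module k M] (T : ℕ → M →ₗ[k] M)
    (f : ℕ → M) (b : ℕ) :
    triangularSolve T f b = f b - ∑ i ∈ range b, T (b - i) (triangularSolve T f i) := by
  rw [triangularSolve, Finset.sum_range]

lemma eq_zero_of_triangular {M : Type*} [AddCommGroup M] [Module k M] (T : ℕ → M →ₗ[k] M)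
    (hT : T 0 = LinearMap.id) (δ : ℕ → M) (J : ℕ) (hδ : ∀ b, J < b → δ b = 0)
    (h : ∀ a ≤ J, ∑ b ∈ range (a + 1), T (a - b) (δ b) = 0) (b : ℕ) : δ b = 0 := by
  induction b using Nat.strong_induction_on with
  | _ b ih =>
    rcases lt_or_ge J b with hb | hb
    · exact hδ b hb
    have := h b hb
    rw [Finset.sum_range_succ, Finset.sum_eq_zero fun i hi => by
      rw [ih i (mem_range.1 hi), map_zero]] at this
    simpa [hT] using this

variable (k) in
open Classical in
/-- The result of multiplying a normal word on the right by the `a`-th elementary symmetric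
function of the pseudo-roots attached to `x`. -/
def actWord (x : Finset (Fin n)) : List (Letter n) → ℕ → WordSpace k n
  | [], a => appendLetter k x a (word k [])
  | (v, j) :: l, a =>
    if a = 0 ∨ CanAppend ((v, j) :: l) x then appendLetter k x a (word k ((v, j) :: l))
    else
      appendLetter k v (j + a) (word k l) - actWord x l (j + a)
        - ∑ b ∈ range j, appendLetter k x (j + a - b) (triangularSolve (appendLetter k x)
            (fun b => appendLetter k v b (word k l) - actWord x l b) b)
        + appendLetter k x a (actWord x l j + ∑ b ∈ range j, appendLetter k x (j - b)
            (triangularSolve (appendLetter k x)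
              (fun b => appendLetter k v b (word k l) - actWord x l b) b))

lemma actWord_of_canAppend {x : Finset (Fin n)} {l : List (Letter n)} (h : CanAppend l x)
    (a : ℕ) : actWord k x l a = appendLetter k x a (word k l) := by
  match l with
  | [] => rfl
  | (v, j) :: l => rw [actWord, if_pos (Or.inr h)]

lemma actWord_zero (x : Finset (Fin n)) (l : List (Letter n)) : actWord k x l 0 = word k l := by
  match l with
  | [] => simp [actWord]
  | (v, j) :: l => rw [actWord, if_pos (Or.inl rfl)]; simp

variable (k) in
/-- The corrections occurring in the definition of `actWord`. -/
def correction (x v : Finset (Fin n)) (l : List (Letter n)) : ℕ → WordSpace k n :=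
  triangularSolve (appendLetter k x) fun b => appendLetter k v b (word k l) - actWord k x l b

lemma actWord_of_not_canAppend {x v : Finset (Fin n)} {j : ℕ} {l : List (Letter n)}
    (h : ¬ CanAppend ((v, j) :: l) x) {a : ℕ} (ha : 1 ≤ a) :
    actWord k x ((v, j) :: l) a =
      appendLetter k v (j + a) (word k l) - actWord k x l (j + a)
        - ∑ b ∈ range j, appendLetter k x (j + a - b) (correction k x v l b)
        + appendLetter k x a (actWord k x l j
          + ∑ b ∈ range j, appendLetter k x (j - b) (correction k x v l b)) := by
  rw [actWord, if_neg (by simp [h]; omega)]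
  rfl

lemma correction_eq (x v : Finset (Fin n)) (l : List (Letter n)) (b : ℕ) :
    correction k x v l b = appendLetter k v b (word k l) - actWord k x l b
      - ∑ i ∈ range b, appendLetter k x (b - i) (correction k x v l i) :=
  triangularSolve_eq _ _ _

lemma actWord_of_card_lt {x : Finset (Fin n)} {a : ℕ} (l : List (Letter n)) (h : x.card < a) :
    actWord k x l a = 0 := by
  induction l generalizing a with
  | nil => simp [actWord, appendLetter_of_card_lt h]
  | cons p l ih =>
    obtain ⟨v, j⟩ := p
    by_cases hl : CanAppend ((v, j) :: l) x
    · rw [actWord_of_canAppend hl, appendLetter_of_card_lt h, LinearMap.zero_apply]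
    · rw [actWord_of_not_canAppend hl (by omega), appendLetter_of_card_lt h, ih (by omega),
        Finset.sum_eq_zero fun b hb => by
          rw [appendLetter_of_card_lt (by have := mem_range.1 hb; omega), LinearMap.zero_apply]]
      have : ¬¬ (x ⊆ v ∧ v.card = x.card + j) := hl
      rw [appendLetter_of_card_lt (by push Not at this; omega)]
      simp

lemma correction_mem_tailDeg {x v : Finset (Fin n)} {j : ℕ} {l : List (Letter n)}
    (hl : IsNormal l) (hv : CanAppend l v) (hc : v.card = x.card + j)
    (ih : ∀ a, 1 ≤ a → actWord k x l a ∈ tailDeg k x (wordDeg l + a)) (b : ℕ) (hb : b < j) :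
    correction k x v l b ∈ tailDeg k x (wordDeg l + b) := by
  induction b using Nat.strong_induction_on with
  | _ b ihb =>
    rw [correction_eq]
    rcases Nat.eq_zero_or_pos b with rfl | hb0
    · simp [actWord_zero]
    · refine sub_mem (sub_mem (appendLetter_mem_tailDeg_of_ne hb0 hl hv (by omega)) (ih b hb0))
        (sum_mem fun i hi => ?_)
      have hi := mem_range.1 hi
      have := appendLetter_mem_tailDeg (b - i) (ihb i hi (by omega))
      rwa [add_assoc, Nat.add_sub_cancel' hi.le] at this

lemma actWord_mem_tailDeg {x : Finset (Fin n)} {l : List (Letter n)} (hl : IsNormal l) {a : ℕ}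
    (ha : 1 ≤ a) : actWord k x l a ∈ tailDeg k x (wordDeg l + a) := by
  induction l generalizing a with
  | nil => exact appendLetter_mem_tailDeg_of_ne ha trivial trivial (by omega)
  | cons p l ih =>
    obtain ⟨v, j⟩ := p
    by_cases hx : CanAppend ((v, j) :: l) x
    · rw [actWord_of_canAppend hx]
      exact appendLetter_mem_tailDeg a (word_mem_supported ⟨⟨hl, hx⟩, rfl⟩)
    · obtain ⟨hj, hjv, hv, hn⟩ := hl
      have hc : v.card = x.card + j := (not_not.1 hx).2
      have hcor : ∀ b < j, ∀ c, b ≤ c →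
          appendLetter k x (c - b) (correction k x v l b) ∈ tailDeg k x (wordDeg l + c) := by
        intro b hb c hbc
        have := appendLetter_mem_tailDeg (c - b)
          (correction_mem_tailDeg hn hv hc (fun a ha => ih hn ha) b hb)
        rwa [add_assoc, Nat.add_sub_cancel' hbc] at this
      rw [actWord_of_not_canAppend hx ha, wordDeg_cons,
        show j + wordDeg l + a = wordDeg l + (j + a) by ring]
      refine add_mem (sub_mem (sub_mem
        (appendLetter_mem_tailDeg_of_ne (by omega) hn hv (by omega)) (ih hn (by omega)))
        (sum_mem fun b hb => hcor b (mem_range.1 hb) _ (by have := mem_range.1 hb; omega))) ?_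
      rw [← add_assoc]
      exact appendLetter_mem_tailDeg a (add_mem (ih hn hj)
        (sum_mem fun b hb => hcor b (mem_range.1 hb) _ (mem_range.1 hb).le))

variable (k) in
/-- Right multiplication by the `a`-th elementary symmetric function of the pseudo-roots
attached to `x`, as an operator. -/
def act (x : Finset (Fin n)) (a : ℕ) : WordSpace k n →ₗ[k] WordSpace k n :=
  Finsupp.linearCombination k fun l => actWord k x l a

@[simp] lemma act_word (x : Finset (Fin n)) (a : ℕ) (l : List (Letter n)) :
    act k x a (word k l) = actWord k x l a := by
  simp [act]

lemma act_zero (x : Finset (Fin n)) : act k x 0 = LinearMap.id := by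
  ext l : 2
  simp only [LinearMap.coe_comp, Function.comp_apply, Finsupp.lsingle_apply]
  rw [act_word, actWord_zero]
  rfl

lemma act_of_card_lt {x : Finset (Fin n)} {a : ℕ} (h : x.card < a) : act k x a = 0 := by
  ext l : 2
  simp only [LinearMap.coe_comp, Function.comp_apply, Finsupp.lsingle_apply]
  rw [act_word, actWord_of_card_lt l h]
  rfl

lemma act_of_mem_tailSpan {x : Finset (Fin n)} {m : WordSpace k n} (hm : m ∈ tailSpan k x)
    (a : ℕ) : act k x a m = appendLetter k x a m := by
  refine (supported_le_of_word_mem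
    (P := LinearMap.eqLocus (act k x a) (appendLetter k x a)) fun l hl => ?_) hm
  rw [LinearMap.mem_eqLocus, act_word, actWord_of_canAppend hl.2]

lemma act_mem_normalDeg {x : Finset (Fin n)} {d : ℕ} {m : WordSpace k n}
    (hm : m ∈ normalDeg k n d) (a : ℕ) : act k x a m ∈ normalDeg k n (d + a) := by
  rcases Nat.eq_zero_or_pos a with rfl | ha
  · simpa [act_zero] using hm
  refine (supported_le_of_word_mem (P := (normalDeg k n (d + a)).comap (act k x a)) ?_) hm
  rintro l ⟨hl, rfl⟩
  rw [Submodule.mem_comap, act_word]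
  exact tailDeg_le_normalDeg _ _ (actWord_mem_tailDeg hl ha)

lemma act_mem_normalSpan (x : Finset (Fin n)) {m : WordSpace k n}
    (hm : m ∈ normalSpan k n) (a : ℕ) : act k x a m ∈ normalSpan k n := by
  refine (supported_le_of_word_mem (P := (normalSpan k n).comap (act k x a)) ?_) hm
  intro l hl
  exact normalDeg_le_normalSpan _ (act_mem_normalDeg (word_mem_supported ⟨hl, rfl⟩) a)

/-- If `x` is a subset of `v` of codimension `j`, then the generating function of the letters
`(v, _)` is a multiple of that of the letters `(x, _)` by a polynomial of degree `j`. -/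
lemma exists_factor {x v : Finset (Fin n)} {j : ℕ} {l : List (Letter n)}
    (hl : IsNormal ((v, j) :: l)) (hxv : x ⊆ v) (hc : v.card = x.card + j) :
    ∃ c : ℕ → WordSpace k n, c 0 = word k l ∧ (∀ b, 1 ≤ b → b < j → c b ∈ tailSpan k x) ∧
      word k ((v, j) :: l) - c j ∈ tailSpan k x ∧ (∀ b, j < b → c b = 0) ∧
      ∀ a, ∑ b ∈ range (a + 1), act k x (a - b) (c b) = appendLetter k v a (word k l) := by
  have hx : ¬ CanAppend ((v, j) :: l) x := fun h => h ⟨hxv, hc⟩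
  obtain ⟨hj, hjv, hv, hn⟩ := hl
  have hd : ∀ b < j, correction k x v l b ∈ tailSpan k x := fun b hb =>
    tailDeg_le_tailSpan _ _
      (correction_mem_tailDeg hn hv hc (fun a ha => actWord_mem_tailDeg hn ha) b hb)
  have happ : ∀ b < j, ∀ a, appendLetter k x a (correction k x v l b) ∈ tailSpan k x :=
    fun b hb a => tailDeg_le_tailSpan _ _ (appendLetter_mem_tailDeg a
      (correction_mem_tailDeg hn hv hc (fun a ha => actWord_mem_tailDeg hn ha) b hb))
  set G := actWord k x l j + ∑ b ∈ range j, appendLetter k x (j - b) (correction k x v l b)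
    with hG
  have hGmem : G ∈ tailSpan k x :=
    add_mem (tailDeg_le_tailSpan _ _ (actWord_mem_tailDeg hn hj))
      (sum_mem fun b hb => happ b (mem_range.1 hb) _)
  have hd0 : correction k x v l 0 = 0 := by
    rw [correction_eq]; simp [actWord_zero]
  let c : ℕ → WordSpace k n := fun b =>
    (if b = 0 then word k l else 0) + if b < j then correction k x v l b else
      if b = j then word k ((v, j) :: l) - G else 0
  have hclt : ∀ b, b < j → c b = (if b = 0 then word k l else 0) + correction k x v l b :=
    fun b hb => by simp only [c, if_pos hb]
  have hcj : c j = word k ((v, j) :: l) - G := by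
    simp only [c, if_neg (lt_irrefl j), if_true, if_neg (show j ≠ 0 by omega), zero_add]
  have hcgt : ∀ b, j < b → c b = 0 := fun b hb => by
    simp only [c, if_neg (show b ≠ 0 by omega), if_neg (show ¬ b < j by omega),
      if_neg (show b ≠ j by omega), zero_add]
  have hsum : ∀ a, ∀ r ≤ j, 1 ≤ r → ∑ b ∈ range r, act k x (a - b) (c b) =
      actWord k x l a + ∑ b ∈ range r, appendLetter k x (a - b) (correction k x v l b) := by
    intro a r hr hr1
    have : ∀ b ∈ range r, act k x (a - b) (c b) = (if b = 0 then actWord k x l a else 0)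
        + appendLetter k x (a - b) (correction k x v l b) := by
      intro b hb
      have hb := mem_range.1 hb
      rw [hclt b (by omega), map_add, act_of_mem_tailSpan (hd b (by omega))]
      split_ifs with h0
      · subst h0; simp only [act_word, Nat.sub_zero]
      · simp
    rw [Finset.sum_congr rfl this, Finset.sum_add_distrib]
    simp [show 0 < r by omega]
  refine ⟨c, ?_, fun b hb hbj => ?_, ?_, hcgt, fun a => ?_⟩
  · rw [hclt 0 (by omega)]; simp [hd0]
  · rw [hclt b hbj, if_neg (by omega), zero_add]; exact hd b hbj
  · rw [hcj, sub_sub_cancel]; exact hGmem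
  · rcases lt_trichotomy a j with h | rfl | h
    · rw [hsum a (a + 1) (by omega) (by omega), Finset.sum_range_succ, Nat.sub_self,
        appendLetter_zero, LinearMap.id_apply, correction_eq x v l a]
      abel
    · rw [Finset.sum_range_succ, hsum a a le_rfl hj, Nat.sub_self, act_zero, LinearMap.id_apply,
        hcj, appendLetter_word hj hjv, ← hG]
      abel
    · obtain ⟨i, rfl⟩ := Nat.exists_eq_add_of_lt h
      have : ∑ b ∈ range (j + i + 1 + 1), act k x (j + i + 1 - b) (c b) =
          ∑ b ∈ range (j + 1), act k x (j + i + 1 - b) (c b) := by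
        symm
        refine Finset.sum_subset (Finset.range_subset_range.2 (by omega)) fun b _ hb => ?_
        rw [hcgt b (by rw [mem_range] at hb; omega), map_zero]
      rw [this, Finset.sum_range_succ, hsum _ j le_rfl hj, hcj, map_sub, act_word,
        act_of_mem_tailSpan hGmem, show j + i + 1 - j = i + 1 by omega,
        actWord_of_not_canAppend hx (by omega), ← hG, ← add_assoc]
      abel


lemma act_succ_of_word {x y v : Finset (Fin n)} {j : ℕ} {l : List (Letter n)}
    (hl : IsNormal ((v, j) :: l)) (hyx : y ⊆ x) (hxy : x.card = y.card + 1) (hxv : x ⊆ v)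
    (hc : v.card = x.card + j)
    (ih : ∀ m ∈ tailSpan k x ⊔ k ∙ word k l, ∀ a,
      act k x (a + 1) m = act k y (a + 1) m + act k y a (act k x 1 m - act k y 1 m)) (a : ℕ) :
    act k x (a + 1) (word k ((v, j) :: l)) = act k y (a + 1) (word k ((v, j) :: l))
      + act k y a (act k x 1 (word k ((v, j) :: l)) - act k y 1 (word k ((v, j) :: l))) := by
  let err : ℕ → WordSpace k n →ₗ[k] WordSpace k n := fun a =>
    act k x (a + 1) - act k y (a + 1) - act k y a ∘ₗ (act k x 1 - act k y 1)
  have herr : ∀ a m, err a m =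
      act k x (a + 1) m - act k y (a + 1) m - act k y a (act k x 1 m - act k y 1 m) :=
    fun a m => rfl
  have herr0 : ∀ m, err 0 m = 0 := fun m => by simp [herr, act_zero]
  have hker : ∀ m ∈ tailSpan k x ⊔ k ∙ word k l, ∀ a, err a m = 0 := fun m hm a => by
    rw [herr, ih m hm a]; abel
  suffices err a (word k ((v, j) :: l)) = 0 by
    rw [herr, sub_sub, sub_eq_zero] at this; exact this
  have hj := hl.1
  obtain ⟨c, hc0, hct, hcj, hcgt, hcsum⟩ := exists_factor (k := k) hl hxv hc
  have hl' : IsNormal ((v, j + 1) :: l) := ⟨by omega, by omega, hl.2.2.1, hl.2.2.2⟩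
  obtain ⟨c', hc0', -, -, hcgt', hcsum'⟩ :=
    exists_factor (k := k) hl' (hyx.trans hxv) (by omega)
  have hcerr : ∀ b, b ≠ j → ∀ a, err a (c b) = 0 := by
    intro b hb a
    rcases Nat.eq_zero_or_pos b with rfl | hb0
    · rw [hc0]
      exact hker _ (Submodule.mem_sup_right (Submodule.mem_span_singleton_self _)) a
    · rcases lt_or_gt_of_ne hb with h | h
      · exact hker _ (Submodule.mem_sup_left (hct b hb0 h)) a
      · rw [hcgt b h, map_zero]
  have hword : err a (word k ((v, j) :: l)) = err a (c j) := by
    rw [← sub_eq_zero, ← map_sub]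
    exact hker _ (Submodule.mem_sup_left hcj) a
  rw [hword]
  let X : WordSpace k n →ₗ[k] WordSpace k n := act k x 1 - act k y 1
  let e : ℕ → WordSpace k n := fun b => c b + if b = 0 then 0 else X (c (b - 1))
  have hesum : ∀ a, ∑ b ∈ range (a + 1), act k y (a - b) (e b) =
      appendLetter k v a (word k l) - ∑ b ∈ range a, err (a - 1 - b) (c b) := by
    intro a
    have h1 : ∑ b ∈ range (a + 1), act k y (a - b) (e b) =
        ∑ b ∈ range (a + 1), act k y (a - b) (c b)
          + ∑ b ∈ range a, act k y (a - 1 - b) (X (c b)) := by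
      simp only [e, map_add, Finset.sum_add_distrib]
      congr 1
      rw [Finset.sum_range_succ']
      simp only [if_true, map_zero, add_zero, Nat.succ_ne_zero, if_false, Nat.add_sub_cancel]
      refine Finset.sum_congr rfl fun b _ => ?_
      rw [show a - (b + 1) = a - 1 - b by omega]
    rw [h1, ← hcsum a, Finset.sum_range_succ, Finset.sum_range_succ, Nat.sub_self, act_zero,
      act_zero]
    have h2 : ∑ b ∈ range a, err (a - 1 - b) (c b) = ∑ b ∈ range a, act k x (a - b) (c b)
        - ∑ b ∈ range a, act k y (a - b) (c b)
        - ∑ b ∈ range a, act k y (a - 1 - b) (X (c b)) := by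
      rw [← Finset.sum_sub_distrib, ← Finset.sum_sub_distrib]
      refine Finset.sum_congr rfl fun b hb => ?_
      rw [herr, show a - 1 - b + 1 = a - b by have := mem_range.1 hb; omega]
      rfl
    rw [h2]
    abel
  have herrsum : ∀ a, ∑ b ∈ range (a + 1), act k y (a - b) (e b - c' b) =
      - ∑ b ∈ range a, err (a - 1 - b) (c b) := by
    intro a
    simp only [map_sub, Finset.sum_sub_distrib]
    rw [hesum, hcsum']
    abel
  have hzero : ∀ b, e b - c' b = 0 := by
    refine eq_zero_of_triangular (act k y) (act_zero y) _ (j + 1) (fun b hb => ?_) fun a ha => ?_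
    · simp only [e]
      rw [hcgt b (by omega), hcgt' b hb, hcgt (b - 1) (by omega)]
      simp
    · rw [herrsum, neg_eq_zero]
      refine Finset.sum_eq_zero fun b hb => ?_
      have hb := mem_range.1 hb
      by_cases hbj : b = j
      · rw [show a - 1 - b = 0 by omega, herr0]
      · exact hcerr b hbj _
  have := herrsum (j + 1 + a)
  rw [Finset.sum_eq_zero fun b _ => by rw [hzero b, map_zero], eq_comm, neg_eq_zero,
    Finset.sum_eq_single j (fun b _ hb => hcerr b hb _)
      (fun h => absurd (mem_range.2 (by omega)) h)] at this
  rwa [show j + 1 + a - 1 - j = a by omega] at this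

/-- The generating functions of the operators attached to `x` and to `y ⊂ x` of codimension one
differ by a linear factor. -/
lemma act_succ {x y : Finset (Fin n)} (hyx : y ⊆ x) (hxy : x.card = y.card + 1)
    {m : WordSpace k n} (hm : m ∈ normalSpan k n) (a : ℕ) :
    act k x (a + 1) m = act k y (a + 1) m + act k y a (act k x 1 m - act k y 1 m) := by
  let P : Submodule k (WordSpace k n) := ⨅ a, LinearMap.ker
    (act k x (a + 1) - (act k y (a + 1) + act k y a ∘ₗ (act k x 1 - act k y 1)))
  have hP : ∀ m, m ∈ P ↔ ∀ a,
      act k x (a + 1) m = act k y (a + 1) m + act k y a (act k x 1 m - act k y 1 m) := by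
    intro m
    simp only [P, Submodule.mem_iInf, LinearMap.mem_ker, LinearMap.sub_apply, sub_eq_zero]
    rfl
  have htail : tailSpan k x ≤ P := by
    refine supported_le_of_word_mem fun l hl => (hP _).2 fun a => ?_
    have hn : IsNormal ((x, 1) :: l) := ⟨le_rfl, by omega, hl.2, hl.1⟩
    obtain ⟨c, hc0, -, -, hcgt, hcsum⟩ := exists_factor (k := k) hn hyx hxy
    have hx : ∀ a, act k x a (word k l) = appendLetter k x a (word k l) :=
      act_of_mem_tailSpan (word_mem_supported hl)
    have hsum : ∀ a, act k y (a + 1) (word k l) + act k y a (c 1) =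
        appendLetter k x (a + 1) (word k l) := by
      intro a
      rw [← hcsum (a + 1), Finset.sum_range_succ', Finset.sum_range_succ',
        Finset.sum_eq_zero fun b _ => by rw [hcgt _ (by omega), map_zero], hc0]
      simp [add_comm]
    have h1 := hsum 0
    rw [act_zero, LinearMap.id_apply] at h1
    rw [hx, ← hsum a, hx 1, ← h1]
    simp
  suffices normalSpan k n ≤ P from (hP m).1 (this hm) a
  refine supported_le_of_word_mem fun l hl => ?_
  induction l with
  | nil => exact htail (word_mem_supported ⟨trivial, trivial⟩)
  | cons p l ih =>
    obtain ⟨v, j⟩ := p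
    by_cases hx : CanAppend ((v, j) :: l) x
    · exact htail (word_mem_supported ⟨hl, hx⟩)
    · obtain ⟨hxv, hc⟩ := not_not.1 hx
      refine (hP _).2 (act_succ_of_word hl hyx hxy hxv hc fun m hm => (hP m).1 ?_)
      refine (sup_le htail ?_ : _ ≤ P) hm
      rw [Submodule.span_singleton_le_iff_mem]
      exact ih hl.2.2.2

end Words

section Elementary

variable {n : ℕ} {B : Type*} [Ring B]

/-- The `a`-th elementary symmetric function of the pseudo-roots attached to `v`, when `r v` is
the sum of these pseudo-roots. -/
def elemSymm (r : Finset (Fin n) → B) (v : Finset (Fin n)) (a : ℕ) : B :=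
  if a = 0 then 1 else if h : v.Nonempty then
    elemSymm r (v.erase (v.min' h)) a
      + (r v - r (v.erase (v.min' h))) * elemSymm r (v.erase (v.min' h)) (a - 1)
  else 0
termination_by v.card
decreasing_by all_goals exact Finset.card_erase_lt_of_mem (v.min'_mem h)

/-- The pseudo-roots multiply in the same way along any two paths of length two. -/
def HasPathRelations (r : Finset (Fin n) → B) : Prop :=
  ∀ v : Finset (Fin n), ∀ i ∈ v, ∀ j ∈ v, i ≠ j →
    (r v - r (v.erase i)) * (r (v.erase i) - r ((v.erase i).erase j)) =
      (r v - r (v.erase j)) * (r (v.erase j) - r ((v.erase i).erase j))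

variable {r : Finset (Fin n) → B}

@[simp] lemma elemSymm_zero (v : Finset (Fin n)) : elemSymm r v 0 = 1 := by
  rw [elemSymm, if_pos rfl]

lemma elemSymm_of_card_lt {v : Finset (Fin n)} {a : ℕ} (h : v.card < a) :
    elemSymm r v a = 0 := by
  induction hc : v.card using Nat.strong_induction_on generalizing v a with
  | _ c ih =>
    rw [elemSymm, if_neg (by omega)]
    split_ifs with hv
    · have := Finset.card_erase_add_one (v.min'_mem hv)
      rw [ih _ (by omega) (by omega) rfl, ih _ (by omega) (by omega) rfl, mul_zero, add_zero]
    · rfl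

lemma elemSymm_succ (hr : HasPathRelations r) {v : Finset (Fin n)} {i : Fin n} (hi : i ∈ v)
    (a : ℕ) : elemSymm r v (a + 1) =
      elemSymm r (v.erase i) (a + 1) + (r v - r (v.erase i)) * elemSymm r (v.erase i) a := by
  induction hc : v.card using Nat.strong_induction_on generalizing v i a with
  | _ c ih =>
    have hv : v.Nonempty := ⟨i, hi⟩
    rw [elemSymm, if_neg (by omega), dif_pos hv, Nat.add_sub_cancel]
    set m := v.min' hv with hm
    have hmv : m ∈ v := v.min'_mem hv
    by_cases him : i = m
    · rw [him]
    have h1 := ih _ (hc ▸ Finset.card_erase_lt_of_mem hmv) (Finset.mem_erase.2 ⟨him, hi⟩)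
      (hc := rfl)
    have h2 := ih _ (hc ▸ Finset.card_erase_lt_of_mem hi)
      (Finset.mem_erase.2 ⟨Ne.symm him, hmv⟩) (hc := rfl)
    have hrel := hr v i hi m hmv him
    rw [h1, h2, Finset.erase_right_comm (a := m)]
    match a with
    | 0 => simp only [elemSymm_zero, mul_one]; abel
    | a + 1 =>
      rw [h1, h2, Finset.erase_right_comm (a := m)]
      simp only [mul_add, ← mul_assoc, hrel]
      noncomm_ring

lemma elemSymm_one (h0 : r ∅ = 0) (v : Finset (Fin n)) : elemSymm r v 1 = r v := by
  induction hc : v.card using Nat.strong_induction_on generalizing v with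
  | _ c ih =>
    rw [elemSymm, if_neg one_ne_zero]
    split_ifs with hv
    · rw [ih _ (hc ▸ Finset.card_erase_lt_of_mem (v.min'_mem hv)) _ rfl]
      simp
    · rw [Finset.not_nonempty_iff_eq_empty.1 hv, h0]

lemma exists_elemSymm_factor (hr : HasPathRelations r) {x v : Finset (Fin n)} {j : ℕ}
    (hxv : x ⊆ v) (hc : v.card = x.card + j) :
    ∃ g : ℕ → B, (∀ b, j < b → g b = 0) ∧
      ∀ a, ∑ b ∈ range (a + 1), g b * elemSymm r x (a - b) = elemSymm r v a := by
  induction j generalizing v with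
  | zero =>
    obtain rfl : x = v := Finset.eq_of_subset_of_card_le hxv (by omega)
    refine ⟨fun b => if b = 0 then 1 else 0, fun b hb => if_neg (by omega), fun a => ?_⟩
    simp
  | succ j ih =>
    obtain ⟨i, hi, hix⟩ := Finset.exists_mem_notMem_of_card_lt_card (show x.card < v.card by omega)
    have hcard := Finset.card_erase_add_one hi
    obtain ⟨g, hg, hsum⟩ := ih (Finset.subset_erase.2 ⟨hxv, hix⟩) (by omega)
    refine ⟨fun b => g b + if b = 0 then 0 else (r v - r (v.erase i)) * g (b - 1),
      fun b hb => ?_, fun a => ?_⟩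
    · simp [hg b (by omega), hg (b - 1) (by omega)]
    · match a with
      | 0 => simpa using hsum 0
      | a + 1 =>
        rw [elemSymm_succ hr hi, ← hsum, ← hsum]
        simp only [add_mul, Finset.sum_add_distrib]
        congr 1
        rw [Finset.sum_range_succ', Finset.mul_sum]
        simp [mul_assoc]

variable {k : Type} [Field k] [Algebra k B]

/-- The product in `B` of the letters of a word, the letter `(v, a)` being sent to `e v a`. -/
def wordProd (e : Finset (Fin n) → ℕ → B) : List (Letter n) → B
  | [] => 1
  | (v, j) :: l => wordProd e l * e v j

variable (k) in
/-- The linear map sending a word to the product of its letters. -/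
def eval (e : Finset (Fin n) → ℕ → B) : WordSpace k n →ₗ[k] B :=
  Finsupp.linearCombination k (wordProd e)

@[simp] lemma eval_word (e : Finset (Fin n) → ℕ → B) (l : List (Letter n)) :
    eval k e (word k l) = wordProd e l := by
  simp [eval]

lemma eval_appendLetter (x : Finset (Fin n)) (a : ℕ) (m : WordSpace k n) :
    eval k (elemSymm r) (appendLetter k x a m) = eval k (elemSymm r) m * elemSymm r x a := by
  rcases Nat.eq_zero_or_pos a with rfl | ha
  · simp
  rcases le_or_gt a x.card with hx | hx
  · induction m using Finsupp.induction_linear with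
    | zero => simp
    | add f g hf hg => simp [hf, hg, add_mul]
    | single l c =>
      rw [← mul_one c, ← smul_eq_mul, ← Finsupp.smul_single, map_smul, appendLetter_word ha hx,
        map_smul, map_smul, eval_word, eval_word, wordProd, smul_mul_assoc]
  · simp [appendLetter_of_card_lt hx, elemSymm_of_card_lt hx]

lemma eval_act_of_word (hr : HasPathRelations r) {x v : Finset (Fin n)} {j : ℕ}
    {l : List (Letter n)} (hl : IsNormal ((v, j) :: l)) (hxv : x ⊆ v)
    (hc : v.card = x.card + j)
    (ih : ∀ m ∈ tailSpan k x ⊔ k ∙ word k l, ∀ a,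
      eval k (elemSymm r) (act k x a m) = eval k (elemSymm r) m * elemSymm r x a) (a : ℕ) :
    eval k (elemSymm r) (act k x a (word k ((v, j) :: l))) =
      eval k (elemSymm r) (word k ((v, j) :: l)) * elemSymm r x a := by
  let err : ℕ → WordSpace k n →ₗ[k] B := fun a =>
    LinearMap.mulRight k (elemSymm r x a) ∘ₗ eval k (elemSymm r) - eval k (elemSymm r) ∘ₗ act k x a
  have herr : ∀ a m, err a m = eval k (elemSymm r) m * elemSymm r x a - eval k (elemSymm r) (act k x a m) :=
    fun a m => rfl
  have herr0 : ∀ m, err 0 m = 0 := fun m => by simp [herr, act_zero]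
  have hker : ∀ m ∈ tailSpan k x ⊔ k ∙ word k l, ∀ a, err a m = 0 := fun m hm a => by
    rw [herr, ih m hm a, sub_self]
  suffices err a (word k ((v, j) :: l)) = 0 by
    rw [herr, sub_eq_zero] at this; exact this.symm
  obtain ⟨c, hc0, hct, hcj, hcgt, hcsum⟩ := exists_factor (k := k) hl hxv hc
  obtain ⟨g, hg, hgsum⟩ := exists_elemSymm_factor hr hxv hc
  have hcerr : ∀ b, b ≠ j → ∀ a, err a (c b) = 0 := by
    intro b hb a
    rcases Nat.eq_zero_or_pos b with rfl | hb0
    · rw [hc0]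
      exact hker _ (Submodule.mem_sup_right (Submodule.mem_span_singleton_self _)) a
    · rcases lt_or_gt_of_ne hb with h | h
      · exact hker _ (Submodule.mem_sup_left (hct b hb0 h)) a
      · rw [hcgt b h, map_zero]
  have hword : err a (word k ((v, j) :: l)) = err a (c j) := by
    rw [← sub_eq_zero, ← map_sub]
    exact hker _ (Submodule.mem_sup_left hcj) a
  rw [hword]
  have herrsum : ∀ a, ∑ b ∈ range (a + 1),
      LinearMap.mulRight k (elemSymm r x (a - b)) (eval k (elemSymm r) (c b) - wordProd (elemSymm r) l * g b) =
        ∑ b ∈ range (a + 1), err (a - b) (c b) := by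
    intro a
    have h := congrArg (eval k (elemSymm r)) (hcsum a)
    rw [eval_appendLetter, eval_word, ← hgsum a, Finset.mul_sum, map_sum] at h
    simp only [herr, map_sub, Finset.sum_sub_distrib, h, LinearMap.mulRight_apply, mul_assoc]
  have hzero : ∀ b, eval k (elemSymm r) (c b) - wordProd (elemSymm r) l * g b = 0 := by
    refine eq_zero_of_triangular (fun a => LinearMap.mulRight k (elemSymm r x a)) (by simp) _ j
      (fun b hb => by simp [hcgt b hb, hg b hb]) fun a ha => ?_
    rw [herrsum]
    refine Finset.sum_eq_zero fun b hb => ?_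
    by_cases hbj : b = j
    · rw [show a - b = 0 by have := mem_range.1 hb; omega, herr0]
    · exact hcerr b hbj _
  have := herrsum (j + a)
  rw [Finset.sum_eq_zero fun b _ => by rw [hzero b, map_zero], eq_comm,
    Finset.sum_eq_single j (fun b _ hb => hcerr b hb _)
      (fun h => absurd (mem_range.2 (by omega)) h)] at this
  rwa [Nat.add_sub_cancel_left] at this

lemma eval_act (hr : HasPathRelations r) (x : Finset (Fin n)) {m : WordSpace k n}
    (hm : m ∈ normalSpan k n) (a : ℕ) :
    eval k (elemSymm r) (act k x a m) = eval k (elemSymm r) m * elemSymm r x a := by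
  let P : Submodule k (WordSpace k n) := ⨅ a, LinearMap.ker
    (eval k (elemSymm r) ∘ₗ act k x a - LinearMap.mulRight k (elemSymm r x a) ∘ₗ eval k (elemSymm r))
  have hP : ∀ m, m ∈ P ↔ ∀ a, eval k (elemSymm r) (act k x a m) = eval k (elemSymm r) m * elemSymm r x a := by
    intro m
    simp only [P, Submodule.mem_iInf, LinearMap.mem_ker, LinearMap.sub_apply, sub_eq_zero]
    rfl
  have htail : tailSpan k x ≤ P := fun m hm => (hP m).2 fun a => by
    rw [act_of_mem_tailSpan hm, eval_appendLetter]
  suffices normalSpan k n ≤ P from (hP m).1 (this hm) a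
  refine supported_le_of_word_mem fun l hl => ?_
  induction l with
  | nil => exact htail (word_mem_supported ⟨trivial, trivial⟩)
  | cons p l ih =>
    obtain ⟨v, j⟩ := p
    by_cases hx : CanAppend ((v, j) :: l) x
    · exact htail (word_mem_supported ⟨hl, hx⟩)
    · obtain ⟨hxv, hc⟩ := not_not.1 hx
      refine (hP _).2 (eval_act_of_word hr hl hxv hc fun m hm => (hP m).1 ?_)
      refine (sup_le htail ?_ : _ ≤ P) hm
      rw [Submodule.span_singleton_le_iff_mem]
      exact ih hl.2.2.2

end Elementary

section Comparison

variable {k : Type} [Field k] {n : ℕ} {B : Type} [Ring B] [Algebra k B]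

lemma rGen_coe (A : SubsetIdx n) : rGen k n A.1 = FreeAlgebra.ι k A := dif_pos A.2

lemma rGen_empty : rGen k n ∅ = 0 := dif_neg Finset.not_nonempty_empty

variable (k n) in
lemma one_mem_FreeADeg : (1 : FreeA k n) ∈ FreeADeg k n 0 :=
  Submodule.subset_span ⟨[], rfl, rfl⟩

lemma rGen_mem_FreeADeg (A : Finset (Fin n)) : rGen k n A ∈ FreeADeg k n 1 := by
  by_cases h : A.Nonempty
  · exact Submodule.subset_span ⟨[⟨A, h⟩], rfl, by simp [rGen, h]⟩
  · rw [rGen, dif_neg h]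
    exact zero_mem _

lemma mul_mem_FreeADeg {a b : ℕ} {x y : FreeA k n} (hx : x ∈ FreeADeg k n a)
    (hy : y ∈ FreeADeg k n b) : x * y ∈ FreeADeg k n (a + b) := by
  have : FreeADeg k n a * FreeADeg k n b ≤ FreeADeg k n (a + b) := by
    rw [FreeADeg, FreeADeg, Submodule.span_mul_span, Submodule.span_le]
    rintro _ ⟨_, ⟨l, rfl, rfl⟩, _, ⟨l', rfl, rfl⟩, rfl⟩
    exact Submodule.subset_span ⟨l ++ l', by simp, by simp⟩
  exact this (Submodule.mul_mem_mul hx hy)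

/-- The image of the degree-`d` component of the free algebra. -/
abbrev imageDeg (π : FreeA k n →ₐ[k] B) (d : ℕ) : Submodule k B :=
  (FreeADeg k n d).map π.toLinearMap

lemma one_mem_imageDeg (π : FreeA k n →ₐ[k] B) : (1 : B) ∈ imageDeg π 0 :=
  ⟨1, one_mem_FreeADeg k n, map_one π⟩

lemma rGen_mem_imageDeg (π : FreeA k n →ₐ[k] B) (A : Finset (Fin n)) :
    π (rGen k n A) ∈ imageDeg π 1 :=
  ⟨_, rGen_mem_FreeADeg A, rfl⟩

lemma mul_mem_imageDeg (π : FreeA k n →ₐ[k] B) {a b : ℕ} {x y : B} (hx : x ∈ imageDeg π a)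
    (hy : y ∈ imageDeg π b) : x * y ∈ imageDeg π (a + b) := by
  obtain ⟨x, hx, rfl⟩ := hx
  obtain ⟨y, hy, rfl⟩ := hy
  exact ⟨x * y, mul_mem_FreeADeg hx hy, map_mul π x y⟩

/-- If evaluation of normal words intertwines operators of degree one on words with right
multiplication by the generators, and has a left inverse, then the normal words form a
homogeneous basis. -/
lemma rank_imageDeg (π : FreeA k n →ₐ[k] B) (e : Finset (Fin n) → ℕ → B)
    (he : ∀ v a, e v a ∈ imageDeg π a) (R : SubsetIdx n → WordSpace k n →ₗ[k] WordSpace k n)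
    (hR : ∀ A d, ∀ m ∈ normalDeg k n d, R A m ∈ normalDeg k n (d + 1))
    (heval : ∀ A, ∀ m ∈ normalSpan k n,
      eval k e (R A m) = eval k e m * π (rGen k n A.1))
    (ψ : B →ₗ[k] WordSpace k n) (hψ : ∀ l, IsNormal l → ψ (wordProd e l) = word k l) (d : ℕ) :
    Module.rank k (imageDeg π d) = Module.rank k (normalDeg k n d) := by
  have hψ' : ∀ m ∈ normalSpan k n, ψ (eval k e m) = m := by
    intro m hm
    refine (supported_le_of_word_mem
      (P := LinearMap.eqLocus (ψ ∘ₗ eval k e) LinearMap.id) fun l hl => ?_) hm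
    simp only [LinearMap.mem_eqLocus, LinearMap.comp_apply, eval_word, hψ l hl, LinearMap.id_apply]
  have hle : (normalDeg k n d).map (eval k e) ≤ imageDeg π d := by
    rw [Submodule.map_le_iff_le_comap]
    refine supported_le_of_word_mem ?_
    rintro l ⟨-, rfl⟩
    rw [Submodule.mem_comap, eval_word]
    induction l with
    | nil => exact one_mem_imageDeg π
    | cons p l ih =>
      rw [wordDeg_cons, add_comm]
      exact mul_mem_imageDeg π ih (he _ _)
  have hge : imageDeg π d ≤ (normalDeg k n d).map (eval k e) := by
    clear hle
    rw [imageDeg, FreeADeg, Submodule.map_span, Submodule.span_le]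
    rintro _ ⟨_, ⟨l, rfl, rfl⟩, rfl⟩
    induction l using List.reverseRecOn with
    | nil => exact ⟨word k [], word_mem_supported ⟨trivial, rfl⟩, by simp [wordProd]⟩
    | append_singleton l A ih =>
      obtain ⟨m, hm, hml⟩ := ih
      refine ⟨R A m, by simpa using hR A _ m hm, ?_⟩
      rw [heval A m (normalDeg_le_normalSpan _ hm), hml, rGen_coe]
      simp
  rw [hge.antisymm hle]
  refine (LinearEquiv.rank_eq (LinearEquiv.ofBijective
    ((eval k e).submoduleMap (normalDeg k n d)) ⟨fun m m' h => ?_,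
      LinearMap.submoduleMap_surjective _ _⟩)).symm
  have h' := congrArg (fun y => ψ y.1) h
  simp only [LinearMap.submoduleMap_coe_apply] at h'
  rw [hψ' _ (normalDeg_le_normalSpan _ m.2), hψ' _ (normalDeg_le_normalSpan _ m'.2)] at h'
  exact Subtype.ext h'

lemma sub_mul_sub_eq_iff {a b c d : B} :
    (a - b) * (b - d) = (a - c) * (c - d) ↔
      a * (b - c) + (b - c) * d - b ^ 2 + c ^ 2 = 0 := by
  rw [← sub_eq_zero]
  apply Eq.congr_left
  noncomm_ring

lemma sub_mul_add_mul_sub_eq_zero {a b c d s : B}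
    (h : s + d * (b - d) + b * (a - b) = s + d * (c - d) + c * (a - c)) :
    (b - c) * a + d * (b - c) - b ^ 2 + c ^ 2 = 0 := by
  rw [← sub_eq_zero] at h
  rw [← h]
  noncomm_ring

end Comparison

section Qn

variable (k : Type) [Field k] (n : ℕ)

/-- The images of the generators in `Q_n`. -/
abbrev qGen (A : Finset (Fin n)) : Qn k n := QnMk k n (rGen k n A)

lemma hasPathRelations_qGen : HasPathRelations (qGen k n) := by
  intro v i hi j hj _
  have h : QnMk k n (fRel k n v i j) = QnMk k n 0 :=
    RingQuot.mkAlgHom_rel k (QnRel.rel v i j hi hj)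
  simp only [fRel, map_add, map_sub, map_mul, map_pow, map_zero] at h
  exact sub_mul_sub_eq_iff.2 h

instance : AddCommGroup (normalSpan k n) := Submodule.addCommGroup _

/-- The restriction of `act` to the normal words. -/
def normalAct (x : Finset (Fin n)) (a : ℕ) : Module.End k (normalSpan k n) :=
  (act k x a).restrict fun _ hm => act_mem_normalSpan x hm a

lemma coe_normalAct (x : Finset (Fin n)) (a : ℕ) (m : normalSpan k n) :
    (normalAct k n x a m : WordSpace k n) = act k x a m := rfl

lemma normalAct_succ {v : Finset (Fin n)} {i : Fin n} (hi : i ∈ v) (a : ℕ) :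
    normalAct k n v (a + 1) = normalAct k n (v.erase i) (a + 1)
      + normalAct k n (v.erase i) a * (normalAct k n v 1 - normalAct k n (v.erase i) 1) := by
  refine LinearMap.ext fun m => Subtype.ext ?_
  exact act_succ (Finset.erase_subset i v) (Finset.card_erase_add_one hi).symm m.2 a

lemma normalAct_zero (x : Finset (Fin n)) : normalAct k n x 0 = 1 := by
  refine LinearMap.ext fun m => Subtype.ext ?_
  rw [coe_normalAct, act_zero]
  rfl

lemma normalAct_of_card_lt {x : Finset (Fin n)} {a : ℕ} (h : x.card < a) :
    normalAct k n x a = 0 := by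
  refine LinearMap.ext fun m => Subtype.ext ?_
  rw [coe_normalAct, act_of_card_lt h]
  rfl

/-- The right action of the free algebra on the normal words which factors through `Q_n`. -/
def freeAct : FreeA k n →ₐ[k] (Module.End k (normalSpan k n))ᵐᵒᵖ :=
  FreeAlgebra.lift k fun A => MulOpposite.op (normalAct k n A.1 1)

lemma freeAct_rGen (A : Finset (Fin n)) :
    freeAct k n (rGen k n A) = MulOpposite.op (normalAct k n A 1) := by
  by_cases h : A.Nonempty
  · rw [rGen, dif_pos h, freeAct, FreeAlgebra.lift_ι_apply]
  · rw [rGen, dif_neg h, map_zero, normalAct_of_card_lt k n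
      (by rw [Finset.not_nonempty_iff_eq_empty.1 h]; simp), MulOpposite.op_zero]

lemma freeAct_fRel {v : Finset (Fin n)} {i j : Fin n} (hi : i ∈ v) (hj : j ∈ v) :
    freeAct k n (fRel k n v i j) = 0 := by
  rcases eq_or_ne i j with rfl | hij
  · simp [fRel]
  apply MulOpposite.unop_injective
  simp only [fRel, map_add, map_sub, map_mul, map_pow, freeAct_rGen, MulOpposite.unop_add,
    MulOpposite.unop_sub, MulOpposite.unop_mul, MulOpposite.unop_pow, MulOpposite.unop_op,
    MulOpposite.unop_zero]
  have h1 := normalAct_succ k n hi 1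
  rw [normalAct_succ k n (Finset.mem_erase.2 ⟨hij.symm, hj⟩) 1] at h1
  have h2 := normalAct_succ k n hj 1
  rw [normalAct_succ k n (Finset.mem_erase.2 ⟨hij, hi⟩) 1, Finset.erase_right_comm] at h2
  exact sub_mul_add_mul_sub_eq_zero (h1.symm.trans h2)

/-- The right action of `Q_n` on the normal words. -/
def qnAct : Qn k n →ₐ[k] (Module.End k (normalSpan k n))ᵐᵒᵖ :=
  RingQuot.liftAlgHom k ⟨freeAct k n, by
    rintro _ _ ⟨v, i, j, hi, hj⟩
    rw [freeAct_fRel k n hi hj, map_zero]⟩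

lemma qnAct_elemSymm (v : Finset (Fin n)) (a : ℕ) :
    qnAct k n (elemSymm (qGen k n) v a) = MulOpposite.op (normalAct k n v a) := by
  have hgen : ∀ A, qnAct k n (qGen k n A) = MulOpposite.op (normalAct k n A 1) := fun A => by
    rw [← freeAct_rGen]
    exact RingQuot.liftAlgHom_mkAlgHom_apply k _ _ _
  induction hc : v.card using Nat.strong_induction_on generalizing v a with
  | _ c ih =>
    match a with
    | 0 => rw [elemSymm_zero, normalAct_zero, map_one, MulOpposite.op_one]
    | a + 1 =>
      rcases v.eq_empty_or_nonempty with rfl | ⟨i, hi⟩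
      · rw [elemSymm_of_card_lt (by simp), normalAct_of_card_lt k n (by simp), map_zero,
          MulOpposite.op_zero]
      · have hcard := hc ▸ Finset.card_erase_lt_of_mem hi
        rw [elemSymm_succ (hasPathRelations_qGen k n) hi, normalAct_succ k n hi, map_add, map_mul,
          map_sub, hgen, hgen, ih _ hcard _ _ rfl, ih _ hcard _ _ rfl]
        rfl

lemma elemSymm_qGen_mem (v : Finset (Fin n)) (a : ℕ) :
    elemSymm (qGen k n) v a ∈ imageDeg (QnMk k n) a := by
  induction hc : v.card using Nat.strong_induction_on generalizing v a with
  | _ c ih =>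
    match a with
    | 0 => rw [elemSymm_zero]; exact one_mem_imageDeg _
    | a + 1 =>
      rcases v.eq_empty_or_nonempty with rfl | ⟨i, hi⟩
      · rw [elemSymm_of_card_lt (by simp)]; exact zero_mem _
      · have hcard := hc ▸ Finset.card_erase_lt_of_mem hi
        rw [elemSymm_succ (hasPathRelations_qGen k n) hi]
        refine add_mem (ih _ hcard _ _ rfl) ?_
        rw [add_comm]
        exact mul_mem_imageDeg _ (sub_mem (rGen_mem_imageDeg _ _) (rGen_mem_imageDeg _ _))
          (ih _ hcard _ _ rfl)

/-- The action of an element of `Q_n` on the empty word. -/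
def qnOrbit : Qn k n →ₗ[k] WordSpace k n :=
  (normalSpan k n).subtype
    ∘ₗ LinearMap.applyₗ (⟨word k [], word_mem_supported trivial⟩ : normalSpan k n)
    ∘ₗ (MulOpposite.opLinearEquiv k).symm.toLinearMap ∘ₗ (qnAct k n).toLinearMap

lemma qnOrbit_apply (x : Qn k n) : qnOrbit k n x =
    ((qnAct k n x).unop ⟨word k [], word_mem_supported trivial⟩ : normalSpan k n) := rfl

lemma qnOrbit_wordProd (l : List (Letter n)) (hl : IsNormal l) :
    qnOrbit k n (wordProd (elemSymm (qGen k n)) l) = word k l := by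
  induction l with
  | nil => rw [qnOrbit_apply, wordProd, map_one]; rfl
  | cons p l ih =>
    obtain ⟨v, j⟩ := p
    rw [qnOrbit_apply, wordProd, map_mul, MulOpposite.unop_mul, Module.End.mul_apply,
      qnAct_elemSymm, MulOpposite.unop_op, coe_normalAct, ← qnOrbit_apply, ih hl.2.2.2, act_word,
      actWord_of_canAppend hl.2.2.1, appendLetter_word hl.1 hl.2.1]

lemma rank_QnDeg (d : ℕ) :
    Module.rank k (QnDeg k n d) = Module.rank k (normalDeg k n d) :=
  rank_imageDeg (QnMk k n) (elemSymm (qGen k n)) (elemSymm_qGen_mem k n)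
    (fun A => act k A.1 1) (fun _ _ _ hm => act_mem_normalDeg hm 1)
    (fun A _ hm => by
      rw [eval_act (hasPathRelations_qGen k n) _ hm, elemSymm_one (r := qGen k n) (by rw [qGen, rGen_empty, map_zero])])
    (qnOrbit k n) (qnOrbit_wordProd k n) d

end Qn

section Chains

variable {n : ℕ} {B : Type*} [Ring B]

/-- The product of the `r w` over the first `a` subsets `w` of a descending path starting
at `v`. -/
def chainProd (r : Finset (Fin n) → B) (v : Finset (Fin n)) (a : ℕ) : B :=
  if a = 0 then 1 else if h : v.Nonempty then
    r v * chainProd r (v.erase (v.min' h)) (a - 1)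
  else 0
termination_by v.card
decreasing_by exact Finset.card_erase_lt_of_mem (v.min'_mem h)

variable {r : Finset (Fin n) → B}

lemma chainProd_zero (v : Finset (Fin n)) : chainProd r v 0 = 1 := by
  rw [chainProd, if_pos rfl]

lemma chainProd_succ (hr : ∀ v : Finset (Fin n), ∀ i ∈ v, ∀ j ∈ v,
      r v * r (v.erase i) = r v * r (v.erase j)) {v : Finset (Fin n)} {i : Fin n} (hi : i ∈ v)
    (a : ℕ) : chainProd r v (a + 1) = r v * chainProd r (v.erase i) a := by
  induction hc : v.card using Nat.strong_induction_on generalizing v i a with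
  | _ c ih =>
    have hv : v.Nonempty := ⟨i, hi⟩
    rw [chainProd, if_neg (by omega), dif_pos hv, Nat.add_sub_cancel]
    set m := v.min' hv
    have hmv : m ∈ v := v.min'_mem hv
    by_cases him : i = m
    · rw [him]
    match a with
    | 0 => rw [chainProd_zero, chainProd_zero]
    | a + 1 =>
      rw [ih _ (hc ▸ Finset.card_erase_lt_of_mem hmv) (Finset.mem_erase.2 ⟨him, hi⟩) _ rfl,
        ih _ (hc ▸ Finset.card_erase_lt_of_mem hi) (Finset.mem_erase.2 ⟨Ne.symm him, hmv⟩) _ rfl,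
        Finset.erase_right_comm (a := m), ← mul_assoc, ← mul_assoc, hr v i hi m hmv]

lemma chainProd_mul (hr : ∀ v : Finset (Fin n), ∀ i ∈ v, ∀ j ∈ v,
      r v * r (v.erase i) = r v * r (v.erase j)) {x v : Finset (Fin n)} {j : ℕ}
    (hx : x.Nonempty) (hxv : x ⊆ v) (hc : v.card = x.card + j) :
    chainProd r v j * r x = chainProd r v (j + 1) := by
  induction j generalizing v with
  | zero =>
    obtain rfl : x = v := Finset.eq_of_subset_of_card_le hxv (by omega)
    obtain ⟨i, hi⟩ := hx
    rw [chainProd_succ hr hi, chainProd_zero, chainProd_zero, one_mul, mul_one]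
  | succ j ih =>
    obtain ⟨i, hi, hix⟩ := Finset.exists_mem_notMem_of_card_lt_card (show x.card < v.card by omega)
    have hcard := Finset.card_erase_add_one hi
    rw [chainProd_succ hr hi, chainProd_succ hr hi, mul_assoc,
      ih (Finset.subset_erase.2 ⟨hxv, hix⟩) (by omega)]

open Classical in
/-- The effect on words of right multiplication by the generator `r_x` of `gn`. -/
def shiftWord (x : Finset (Fin n)) : List (Letter n) → List (Letter n)
  | [] => [(x, 1)]
  | (v, j) :: l => if CanAppend ((v, j) :: l) x then (x, 1) :: (v, j) :: l else (v, j + 1) :: l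

lemma shiftWord_of_canAppend {x : Finset (Fin n)} {l : List (Letter n)} (h : CanAppend l x) :
    shiftWord x l = (x, 1) :: l := by
  match l with
  | [] => rfl
  | (v, j) :: l => rw [shiftWord, if_pos h]

lemma shiftWord_of_subset {x v : Finset (Fin n)} {j : ℕ} (hxv : x ⊆ v)
    (hc : v.card = x.card + j) (l : List (Letter n)) :
    shiftWord x ((v, j) :: l) = (v, j + 1) :: l := by
  rw [shiftWord, if_neg (show ¬CanAppend ((v, j) :: l) x from not_not.2 ⟨hxv, hc⟩)]

lemma exists_shiftWord_eq (x : Finset (Fin n)) (l : List (Letter n)) :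
    ∃ v j l', shiftWord x l = (v, j + 1) :: l' ∧ x ⊆ v ∧ v.card = x.card + j := by
  by_cases h : CanAppend l x
  · exact ⟨x, 0, l, shiftWord_of_canAppend h, subset_rfl, rfl⟩
  · match l with
    | [] => exact absurd trivial h
    | (v, j) :: l =>
      obtain ⟨hxv, hc⟩ := not_not.1 h
      exact ⟨v, j, l, shiftWord_of_subset hxv hc l, hxv, hc⟩

lemma shiftWord_erase_shiftWord {v : Finset (Fin n)} {i j : Fin n} (hi : i ∈ v) (hj : j ∈ v)
    (l : List (Letter n)) :
    shiftWord (v.erase i) (shiftWord v l) = shiftWord (v.erase j) (shiftWord v l) := by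
  obtain ⟨w, a, l', h, hvw, hc⟩ := exists_shiftWord_eq v l
  have h1 := Finset.card_erase_add_one hi
  have h2 := Finset.card_erase_add_one hj
  rw [h, shiftWord_of_subset ((Finset.erase_subset i v).trans hvw) (by omega),
    shiftWord_of_subset ((Finset.erase_subset j v).trans hvw) (by omega)]

lemma isNormal_shiftWord {x : Finset (Fin n)} (hx : x.Nonempty) {l : List (Letter n)}
    (hl : IsNormal l) : IsNormal (shiftWord x l) := by
  by_cases h : CanAppend l x
  · rw [shiftWord_of_canAppend h]
    exact ⟨le_rfl, hx.card_pos, h, hl⟩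
  · match l with
    | [] => exact absurd trivial h
    | (v, j) :: l =>
      obtain ⟨hxv, hc⟩ := not_not.1 h
      rw [shiftWord_of_subset hxv hc]
      exact ⟨by omega, by have := hx.card_pos; omega, hl.2.2.1, hl.2.2.2⟩

lemma wordDeg_shiftWord (x : Finset (Fin n)) (l : List (Letter n)) :
    wordDeg (shiftWord x l) = wordDeg l + 1 := by
  by_cases h : CanAppend l x
  · rw [shiftWord_of_canAppend h, wordDeg_cons, add_comm]
  · match l with
    | [] => exact absurd trivial h
    | (v, j) :: l =>
      obtain ⟨hxv, hc⟩ := not_not.1 h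
      rw [shiftWord_of_subset hxv hc, wordDeg_cons, wordDeg_cons]
      omega

lemma wordProd_shiftWord (hr : ∀ v : Finset (Fin n), ∀ i ∈ v, ∀ j ∈ v,
      r v * r (v.erase i) = r v * r (v.erase j)) {x : Finset (Fin n)} (hx : x.Nonempty)
    (l : List (Letter n)) :
    wordProd (chainProd r) (shiftWord x l) = wordProd (chainProd r) l * r x := by
  by_cases h : CanAppend l x
  · rw [shiftWord_of_canAppend h, wordProd, ← chainProd_mul hr hx subset_rfl (j := 0) rfl,
      chainProd_zero, one_mul]
  · match l with
    | [] => exact absurd trivial h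
    | (v, j) :: l =>
      obtain ⟨hxv, hc⟩ := not_not.1 h
      rw [shiftWord_of_subset hxv hc, wordProd, wordProd, mul_assoc, chainProd_mul hr hx hxv hc]

end Chains

section Gn

variable (k : Type) [Field k] (n : ℕ)

/-- The images of the generators in `gn`. -/
abbrev gGen (A : Finset (Fin n)) : Gn k n := GnMk k n (rGen k n A)

lemma gGen_mul_gGen_erase (v : Finset (Fin n)) (i : Fin n) (hi : i ∈ v) (j : Fin n)
    (hj : j ∈ v) :
    gGen k n v * gGen k n (v.erase i) = gGen k n v * gGen k n (v.erase j) := by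
  have h : GnMk k n (hRel k n v i j) = GnMk k n 0 :=
    RingQuot.mkAlgHom_rel k (GnRel.rel v i j hi hj)
  rwa [hRel, map_mul, map_sub, mul_sub, map_zero, sub_eq_zero] at h

lemma chainProd_gGen_mem (v : Finset (Fin n)) (a : ℕ) :
    chainProd (gGen k n) v a ∈ imageDeg (GnMk k n) a := by
  induction a generalizing v with
  | zero => rw [chainProd_zero]; exact one_mem_imageDeg _
  | succ a ih =>
    rcases v.eq_empty_or_nonempty with rfl | ⟨i, hi⟩
    · rw [chainProd, if_neg (by omega), dif_neg Finset.not_nonempty_empty]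
      exact zero_mem _
    · rw [chainProd_succ (gGen_mul_gGen_erase k n) hi, add_comm]
      exact mul_mem_imageDeg _ (rGen_mem_imageDeg _ _) (ih _)

/-- The operator on words given by right multiplication by the generator `r_x` of `gn`. -/
def shift (x : Finset (Fin n)) : Module.End k (WordSpace k n) :=
  Finsupp.lmapDomain k k (shiftWord x)

lemma shift_word (x : Finset (Fin n)) (l : List (Letter n)) :
    shift k n x (word k l) = word k (shiftWord x l) := by
  simp [shift]

/-- The right action of the free algebra on words which factors through `gn`. -/
def freeShift : FreeA k n →ₐ[k] (Module.End k (WordSpace k n))ᵐᵒᵖ :=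
  FreeAlgebra.lift k fun A => MulOpposite.op (shift k n A.1)

lemma freeShift_rGen {A : Finset (Fin n)} (h : A.Nonempty) :
    freeShift k n (rGen k n A) = MulOpposite.op (shift k n A) := by
  rw [rGen, dif_pos h, freeShift, FreeAlgebra.lift_ι_apply]

lemma freeShift_hRel {v : Finset (Fin n)} {i j : Fin n} (hi : i ∈ v) (hj : j ∈ v) :
    freeShift k n (hRel k n v i j) = 0 := by
  rcases eq_or_ne i j with rfl | hij
  · simp [hRel]
  rw [hRel, mul_sub, map_sub]
  refine sub_eq_zero_of_eq ?_
  rw [map_mul, map_mul, freeShift_rGen k n ⟨i, hi⟩,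
    freeShift_rGen k n ⟨j, Finset.mem_erase.2 ⟨hij.symm, hj⟩⟩,
    freeShift_rGen k n ⟨i, Finset.mem_erase.2 ⟨hij, hi⟩⟩,
    ← MulOpposite.op_mul, ← MulOpposite.op_mul]
  congr 1
  ext l : 2
  simp only [LinearMap.coe_comp, Function.comp_apply, Finsupp.lsingle_apply, Module.End.mul_apply]
  rw [shift_word, shift_word, shift_word, shiftWord_erase_shiftWord hi hj]

/-- The right action of `gn` on words. -/
def gnAct : Gn k n →ₐ[k] (Module.End k (WordSpace k n))ᵐᵒᵖ :=
  RingQuot.liftAlgHom k ⟨freeShift k n, by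
    rintro _ _ ⟨v, i, j, hi, hj⟩
    rw [freeShift_hRel k n hi hj, map_zero]⟩

lemma gnAct_gGen {A : Finset (Fin n)} (h : A.Nonempty) :
    gnAct k n (gGen k n A) = MulOpposite.op (shift k n A) := by
  rw [← freeShift_rGen k n h]
  exact RingQuot.liftAlgHom_mkAlgHom_apply k _ _ _

lemma gnAct_chainProd_of_subset {x v : Finset (Fin n)} {j a : ℕ} (hxv : x ⊆ v)
    (hc : v.card = x.card + j) (ha : a ≤ x.card) (l : List (Letter n)) :
    (gnAct k n (chainProd (gGen k n) x a)).unop (word k ((v, j) :: l)) =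
      word k ((v, j + a) :: l) := by
  induction a generalizing x j with
  | zero => rw [chainProd_zero, map_one]; rfl
  | succ a ih =>
    obtain ⟨i, hi⟩ := Finset.card_pos.1 (show 0 < x.card by omega)
    have hcard := Finset.card_erase_add_one hi
    rw [chainProd_succ (gGen_mul_gGen_erase k n) hi, map_mul, MulOpposite.unop_mul,
      Module.End.mul_apply, gnAct_gGen k n ⟨i, hi⟩, MulOpposite.unop_op, shift_word,
      shiftWord_of_subset hxv hc, ih ((Finset.erase_subset i x).trans hxv) (by omega) (by omega),
      add_assoc, add_comm 1 a]

lemma gnAct_chainProd {v : Finset (Fin n)} {a : ℕ} (ha : 1 ≤ a) (hv : a ≤ v.card)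
    {l : List (Letter n)} (hl : CanAppend l v) :
    (gnAct k n (chainProd (gGen k n) v a)).unop (word k l) = word k ((v, a) :: l) := by
  obtain ⟨a, rfl⟩ := Nat.exists_eq_add_of_le' ha
  obtain ⟨i, hi⟩ := Finset.card_pos.1 (show 0 < v.card by omega)
  have hcard := Finset.card_erase_add_one hi
  rw [chainProd_succ (gGen_mul_gGen_erase k n) hi, map_mul, MulOpposite.unop_mul,
    Module.End.mul_apply, gnAct_gGen k n ⟨i, hi⟩, MulOpposite.unop_op, shift_word,
    shiftWord_of_canAppend hl,
    gnAct_chainProd_of_subset k n (Finset.erase_subset i v) (by omega) (by omega), add_comm 1 a]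

/-- The action of an element of `gn` on the empty word. -/
def gnOrbit : Gn k n →ₗ[k] WordSpace k n :=
  LinearMap.applyₗ (word k []) ∘ₗ (MulOpposite.opLinearEquiv k).symm.toLinearMap
    ∘ₗ (gnAct k n).toLinearMap

lemma gnOrbit_apply (x : Gn k n) : gnOrbit k n x = (gnAct k n x).unop (word k []) := rfl

lemma gnOrbit_wordProd (l : List (Letter n)) (hl : IsNormal l) :
    gnOrbit k n (wordProd (chainProd (gGen k n)) l) = word k l := by
  induction l with
  | nil => rw [gnOrbit_apply, wordProd, map_one]; rfl
  | cons p l ih =>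
    obtain ⟨v, j⟩ := p
    rw [gnOrbit_apply, wordProd, map_mul, MulOpposite.unop_mul, Module.End.mul_apply,
      ← gnOrbit_apply, ih hl.2.2.2, gnAct_chainProd k n hl.1 hl.2.1 hl.2.2.1]

lemma rank_GnDeg (d : ℕ) :
    Module.rank k (GnDeg k n d) = Module.rank k (normalDeg k n d) := by
  refine rank_imageDeg (GnMk k n) (chainProd (gGen k n)) (chainProd_gGen_mem k n)
    (fun A => shift k n A.1) (fun A d m hm => ?_) (fun A m hm => ?_)
    (gnOrbit k n) (gnOrbit_wordProd k n) d
  · refine (supported_le_of_word_mem (P := (normalDeg k n (d + 1)).comap (shift k n A.1)) ?_) hm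
    rintro l ⟨hl, rfl⟩
    rw [Submodule.mem_comap, shift_word]
    exact word_mem_supported ⟨isNormal_shiftWord A.2 hl, wordDeg_shiftWord _ l⟩
  · refine (supported_le_of_word_mem
      (P := LinearMap.eqLocus (eval k (chainProd (gGen k n)) ∘ₗ shift k n A.1)
        (LinearMap.mulRight k (gGen k n A.1) ∘ₗ eval k (chainProd (gGen k n))))
      fun l _ => ?_) hm
    rw [LinearMap.mem_eqLocus, LinearMap.comp_apply, LinearMap.comp_apply, shift_word, eval_word,
      eval_word, wordProd_shiftWord (gGen_mul_gGen_erase k n) A.2, LinearMap.mulRight_apply]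

end Gn

end PseudoRoots

theorem dim_QnDeg_eq_dim_GnDeg (k : Type) [Field k] (n : ℕ) (hn : 2 ≤ n) (d : ℕ) :
    Module.rank k (QnDeg k n d) = Module.rank k (GnDeg k n d) := by
  rw [PseudoRoots.rank_QnDeg, PseudoRoots.rank_GnDeg]
end
end
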